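/- For N ≥ 3 the group generated by C-NOTs and local gates is exactly SO(2^N): if G is the subgroup of the orthogonal group O(2^N) generated by all embedded C-NOT gates V_{jk} (1 ≤ j ≠ k ≤ N) together with all local one-rebit orthogonal gates, then G = { A ∈ O(2^N) : Det(A) = 1 }. -/

import Mathlib

open Matrix

noncomputable section

/-- The `N`-fold Kronecker/tensor product of `2×2` real matrices, realized as a `2^N × 2^N`
matrix indexed by bit strings `Fin N → Fin 2`. -/
def tensorString {N : ℕ} (M : Fin N → Matrix (Fin 2) (Fin 2) ℝ) :
    Matrix (Fin N → Fin 2) (Fin N → Fin 2) ℝ :=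
  Matrix.of fun r c => ∏ j, M j (r j) (c j)

/-- The embedded real C-NOT gate with control `j` and target `k`. -/
def cnot {N : ℕ} (j k : Fin N) : Matrix (Fin N → Fin 2) (Fin N → Fin 2) ℝ :=
  Matrix.of fun r c => if r = Function.update c k (c j + c k) then 1 else 0

/-- A local one-rebit gate `R` acting on rebit `k`. -/
def localGate {N : ℕ} (k : Fin N) (R : Matrix (Fin 2) (Fin 2) ℝ) :
    Matrix (Fin N → Fin 2) (Fin N → Fin 2) ℝ :=
  tensorString fun j => if j = k then R else 1

/-- The generating set: all embedded C-NOTs and all local one-rebit orthogonal gates. -/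
def gateSet (N : ℕ) : Set (Matrix.orthogonalGroup (Fin N → Fin 2) ℝ) :=
  {W | (∃ j k, j ≠ k ∧ (W : Matrix (Fin N → Fin 2) (Fin N → Fin 2) ℝ) = cnot j k) ∨
    (∃ (k : Fin N) (R : Matrix (Fin 2) (Fin 2) ℝ), R ∈ Matrix.orthogonalGroup (Fin 2) ℝ ∧
      (W : Matrix (Fin N → Fin 2) (Fin N → Fin 2) ℝ) = localGate k R)}

section Rotations

variable {n : Type*} [DecidableEq n]

/-- The matrix rotating each plane spanned by `x` and `σ x` by the angle `α x`; it is orthogonal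
when `σ` is an involution and `α ∘ σ = -α`. -/
def pairRotation (σ : n → n) (α : n → ℝ) : Matrix n n ℝ :=
  Matrix.of fun r => Real.cos (α r) • Pi.single r 1 + Real.sin (α r) • Pi.single (σ r) 1

theorem pairRotation_transpose {σ : n → n} (hσ : ∀ x, σ (σ x) = x) {α : n → ℝ}
    (hα : ∀ x, α (σ x) = -α x) : (pairRotation σ α)ᵀ = pairRotation σ (-α) := by
  ext r c
  have hrc : r = σ c ↔ c = σ r := ⟨fun h => by rw [h, hσ], fun h => by rw [h, hσ]⟩
  simp only [pairRotation, Matrix.transpose_apply, Matrix.of_apply, Pi.add_apply, Pi.smul_apply,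
    Pi.single_apply, smul_eq_mul, Pi.neg_apply, Real.cos_neg, Real.sin_neg, hrc, eq_comm (a := r)]
  congr 1
  · split_ifs with h <;> simp [h]
  · split_ifs with h <;> simp [h, hα]

variable [Fintype n]

theorem pairRotation_mulVec (σ : n → n) (α v : n → ℝ) (r : n) :
    (pairRotation σ α *ᵥ v) r = Real.cos (α r) * v r + Real.sin (α r) * v (σ r) := by
  change (Real.cos (α r) • Pi.single r 1 + Real.sin (α r) • Pi.single (σ r) 1 : n → ℝ) ⬝ᵥ v = _
  simp [add_dotProduct]

theorem pairRotation_mul {σ : n → n} (hσ : ∀ x, σ (σ x) = x) (α : n → ℝ) {β : n → ℝ}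
    (hβ : ∀ x, β (σ x) = -β x) :
    pairRotation σ α * pairRotation σ β = pairRotation σ (α + β) := by
  refine Matrix.ext_of_mulVec_single fun c => ?_
  rw [← Matrix.mulVec_mulVec]
  ext r
  simp only [pairRotation_mulVec, hσ, hβ, Pi.add_apply, Real.cos_add, Real.sin_add, Real.cos_neg,
    Real.sin_neg]
  ring

theorem pairRotation_mem_orthogonalGroup {σ : n → n} (hσ : ∀ x, σ (σ x) = x) {α : n → ℝ}
    (hα : ∀ x, α (σ x) = -α x) : pairRotation σ α ∈ Matrix.orthogonalGroup n ℝ := by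
  rw [Matrix.mem_orthogonalGroup_iff, pairRotation_transpose hσ hα,
    pairRotation_mul hσ _ (fun x => by simp [hα])]
  refine Matrix.ext_of_mulVec_single fun c => ?_
  ext r
  rw [Matrix.one_mulVec, pairRotation_mulVec]
  simp

/-- The Givens rotation by the angle `θ` in the coordinate plane `(i, j)`. -/
def givens (i j : n) (θ : ℝ) : Matrix n n ℝ :=
  pairRotation (Equiv.swap i j) fun x => if x = i then -θ else if x = j then θ else 0

theorem givens_mulVec {i j : n} (hij : i ≠ j) (θ : ℝ) (v : n → ℝ) :
    givens i j θ *ᵥ v = fun r =>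
      if r = i then Real.cos θ * v i - Real.sin θ * v j
      else if r = j then Real.cos θ * v j + Real.sin θ * v i else v r := by
  ext r
  rw [givens, pairRotation_mulVec]
  split_ifs with h₁ h₂
  · subst h₁; simp [sub_eq_add_neg]
  · subst h₂; simp
  · simp

theorem givens_conj {i j k : n} (hij : i ≠ j) (hjk : j ≠ k) (hik : i ≠ k) (θ : ℝ) :
    givens j k (Real.pi / 2) * givens i j θ * givens j k (-(Real.pi / 2)) = givens i k θ := by
  refine Matrix.ext_of_mulVec_single fun c => ?_
  rw [← Matrix.mulVec_mulVec, ← Matrix.mulVec_mulVec]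
  generalize (Pi.single c 1 : n → ℝ) = v
  simp only [givens_mulVec hij, givens_mulVec hjk, givens_mulVec hik, Real.cos_neg, Real.sin_neg,
    Real.cos_pi_div_two, Real.sin_pi_div_two]
  ext r
  by_cases h₁ : r = i
  · subst h₁; simp [hij, hik]
  by_cases h₂ : r = j
  · subst h₂; simp [hij, hjk, hij.symm, hjk.symm, hik.symm]
  by_cases h₃ : r = k
  · subst h₃; simp [hij, hik, hij.symm, hjk.symm, hik.symm]
  simp [h₁, h₂, h₃]

theorem exists_angle_rotate_to_axis (x y : ℝ) :
    ∃ θ, Real.cos θ * y + Real.sin θ * x = 0 ∧ 0 ≤ Real.cos θ * x - Real.sin θ * y := by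
  set z : ℂ := ⟨x, -y⟩
  have hx : ‖z‖ * Real.cos z.arg = x := Complex.norm_mul_cos_arg z
  have hy : ‖z‖ * Real.sin z.arg = -y := Complex.norm_mul_sin_arg z
  refine ⟨z.arg, by linear_combination -Real.sin z.arg * hx + Real.cos z.arg * hy, ?_⟩
  have h : Real.cos z.arg * x - Real.sin z.arg * y = ‖z‖ := by
    linear_combination ‖z‖ * Real.sin_sq_add_cos_sq z.arg - Real.cos z.arg * hx -
      Real.sin z.arg * hy
  exact h ▸ norm_nonneg z

theorem exists_mem_mulVec_eq_zero {H : Subgroup (Matrix.orthogonalGroup n ℝ)}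
    (hH : ∀ i j, i ≠ j → ∀ θ, ∃ W ∈ H, (W : Matrix n n ℝ) = givens i j θ) (a : n) (v : n → ℝ)
    (t : Finset n) (ha : a ∉ t) :
    ∃ W ∈ H, (∀ i, i ≠ a → i ∉ t → (W : Matrix n n ℝ) *ᵥ Pi.single i 1 = Pi.single i 1) ∧
      (∀ i ∈ t, ((W : Matrix n n ℝ) *ᵥ v) i = 0) ∧
      (t.Nonempty → 0 ≤ ((W : Matrix n n ℝ) *ᵥ v) a) := by
  induction t using Finset.induction_on with
  | empty =>
    exact ⟨1, H.one_mem, fun i _ _ => by rw [Submonoid.coe_one, Matrix.one_mulVec], by simp⟩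
  | insert i t hi ih =>
    obtain ⟨hai, hat⟩ : a ≠ i ∧ a ∉ t := by simpa using ha
    obtain ⟨W, hW, hfix, hzero, -⟩ := ih hat
    set w := (W : Matrix n n ℝ) *ᵥ v with hw
    obtain ⟨θ, hθ, hθ'⟩ := exists_angle_rotate_to_axis (w a) (w i)
    obtain ⟨U, hU, hUe⟩ := hH a i hai θ
    refine ⟨U * W, H.mul_mem hU hW, ?_, ?_, ?_⟩
    · intro j hja hjt
      obtain ⟨hji, hjt⟩ : j ≠ i ∧ j ∉ t := by simpa using hjt
      rw [Submonoid.coe_mul, ← Matrix.mulVec_mulVec, hfix j hja hjt, hUe, givens_mulVec hai]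
      ext r
      split_ifs with h₁ h₂
      · subst h₁; simp [hja.symm, hji.symm]
      · subst h₂; simp [hja.symm, hji.symm]
      · rfl
    · intro j hj
      rw [Submonoid.coe_mul, ← Matrix.mulVec_mulVec, ← hw, hUe, givens_mulVec hai]
      rcases Finset.mem_insert.1 hj with rfl | hj
      · simpa [hai.symm] using hθ
      · have hja : j ≠ a := fun h => hat (h ▸ hj)
        have hji : j ≠ i := fun h => hi (h ▸ hj)
        simpa [hja, hji] using hzero j hj
    · intro _
      rw [Submonoid.coe_mul, ← Matrix.mulVec_mulVec, ← hw, hUe, givens_mulVec hai]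
      simpa using hθ'

theorem row_eq_of_col_eq (C : Matrix.orthogonalGroup n ℝ) {i : n}
    (h : (C : Matrix n n ℝ) *ᵥ Pi.single i 1 = Pi.single i 1) (j : n) :
    (C : Matrix n n ℝ) i j = (1 : Matrix n n ℝ) i j := by
  have hC : (C : Matrix n n ℝ)ᵀ * C = 1 := (Matrix.mem_orthogonalGroup_iff' _ _).1 C.2
  have : (C : Matrix n n ℝ)ᵀ *ᵥ Pi.single i 1 = Pi.single i 1 := by
    rw [← h, Matrix.mulVec_mulVec, hC, Matrix.one_mulVec, h]
  have := congrFun this j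
  simpa [Matrix.mulVec_single_one, Matrix.one_apply, Pi.single_apply, eq_comm] using this

theorem exists_mem_mul_mulVec_single {H : Subgroup (Matrix.orthogonalGroup n ℝ)}
    (hH : ∀ i j, i ≠ j → ∀ θ, ∃ W ∈ H, (W : Matrix n n ℝ) = givens i j θ)
    (A : Matrix.orthogonalGroup n ℝ) (a₀ : n) (s : Finset n) (hs : a₀ ∉ s) :
    ∃ W ∈ H, ∀ i ∈ s,
      ((W * A : Matrix.orthogonalGroup n ℝ) : Matrix n n ℝ) *ᵥ Pi.single i 1 = Pi.single i 1 := by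
  induction s using Finset.induction_on with
  | empty => exact ⟨1, H.one_mem, by simp⟩
  | insert a s has ih =>
    obtain ⟨ha₀, hs⟩ : a₀ ≠ a ∧ a₀ ∉ s := by simpa using hs
    obtain ⟨W, hW, hfix⟩ := ih hs
    obtain ⟨U, hU, hUfix, hUzero, hUa⟩ := exists_mem_mulVec_eq_zero hH a
      (((W * A : Matrix.orthogonalGroup n ℝ) : Matrix n n ℝ) *ᵥ Pi.single a 1)
      (insert a s)ᶜ (by simp)
    have hs_fix : ∀ i ∈ s, ((U * W * A : Matrix.orthogonalGroup n ℝ) : Matrix n n ℝ) *ᵥ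
        Pi.single i 1 = Pi.single i 1 := by
      intro i hi
      rw [mul_assoc, Submonoid.coe_mul, ← Matrix.mulVec_mulVec, hfix i hi]
      exact hUfix i (fun h => has (h ▸ hi)) (by simp [hi])
    refine ⟨U * W, H.mul_mem hU hW, ?_⟩
    rw [Matrix.mulVec_mulVec, ← Submonoid.coe_mul, ← mul_assoc] at hUzero hUa
    generalize U * W * A = C at hs_fix hUzero hUa ⊢
    have hcol : ∀ i, i ≠ a → (C : Matrix n n ℝ) i a = 0 := by
      intro i hia
      by_cases his : i ∈ s
      · rw [row_eq_of_col_eq C (hs_fix i his), Matrix.one_apply_ne hia]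
      · simpa using hUzero i (by simp [hia, his])
    have hsq : (C : Matrix n n ℝ) a a * (C : Matrix n n ℝ) a a = 1 := by
      have hC : (C : Matrix n n ℝ)ᵀ * C = 1 := (Matrix.mem_orthogonalGroup_iff' _ _).1 C.2
      have := congrFun (congrFun hC a) a
      rwa [Matrix.mul_apply, Finset.sum_eq_single a (fun i _ hi => by simp [hcol i hi]) (by simp),
        Matrix.transpose_apply, Matrix.one_apply_eq] at this
    have hnonneg : 0 ≤ (C : Matrix n n ℝ) a a := by
      simpa using hUa ⟨a₀, by simp [ha₀, hs]⟩
    have hone : (C : Matrix n n ℝ) a a = 1 := by nlinarith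
    intro i hi
    rcases Finset.mem_insert.1 hi with rfl | hi
    · ext r
      by_cases hr : r = i
      · subst hr; simpa using hone
      · simpa [hr] using hcol r hr
    · exact hs_fix i hi

/-- A group of matrices of determinant one containing all Givens rotations contains every special
orthogonal matrix. -/
theorem mem_of_det_eq_one {H : Subgroup (Matrix.orthogonalGroup n ℝ)}
    (hdet : ∀ W ∈ H, (W : Matrix n n ℝ).det = 1)
    (hH : ∀ i j, i ≠ j → ∀ θ, ∃ W ∈ H, (W : Matrix n n ℝ) = givens i j θ)
    {A : Matrix.orthogonalGroup n ℝ} (hA : (A : Matrix n n ℝ).det = 1) : A ∈ H := by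
  cases isEmpty_or_nonempty n with
  | inl _ => rw [show A = 1 from Subtype.ext (Subsingleton.elim _ _)]; exact H.one_mem
  | inr h =>
    obtain ⟨a₀⟩ := h
    obtain ⟨W, hW, hfix⟩ := exists_mem_mul_mulVec_single hH A a₀ {a₀}ᶜ (by simp)
    have hC : ((W * A : Matrix.orthogonalGroup n ℝ) : Matrix n n ℝ).det = 1 := by
      rw [Submonoid.coe_mul, Matrix.det_mul, hdet W hW, hA, one_mul]
    rw [← H.mul_mem_cancel_left hW]
    generalize W * A = C at hfix hC
    have hrow : ∀ i, i ≠ a₀ → ∀ j, (C : Matrix n n ℝ) i j = (1 : Matrix n n ℝ) i j :=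
      fun i hi => row_eq_of_col_eq C (hfix i (by simp [hi]))
    have hcol : ∀ j, j ≠ a₀ → ∀ i, (C : Matrix n n ℝ) i j = (1 : Matrix n n ℝ) i j := by
      intro j hj i
      have := congrFun (hfix j (by simp [hj])) i
      simpa [Matrix.one_apply, Pi.single_apply] using this
    have hdiag : (C : Matrix n n ℝ) = Matrix.diagonal fun i => (C : Matrix n n ℝ) i i := by
      ext i j
      by_cases hij : i = j
      · subst hij; simp
      · rw [Matrix.diagonal_apply_ne _ hij]
        by_cases hi : i = a₀
        · rw [hcol j (fun h => hij (hi.trans h.symm)), Matrix.one_apply_ne hij]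
        · rw [hrow i hi, Matrix.one_apply_ne hij]
    have ha₀ : (C : Matrix n n ℝ) a₀ a₀ = 1 := by
      rw [hdiag, Matrix.det_diagonal, Finset.prod_eq_single a₀
        (fun i _ hi => by rw [hrow i hi, Matrix.one_apply_eq]) (by simp)] at hC
      exact hC
    have : C = 1 := by
      refine Subtype.ext ?_
      rw [hdiag]
      ext i j
      by_cases hij : i = j
      · subst hij
        by_cases hi : i = a₀
        · subst hi; simpa using ha₀
        · simp [hrow i hi]
      · simp [hij]
    rw [this]
    exact H.one_mem

end Rotations

section Gates

variable {N : ℕ}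

theorem add_add_cancel_bit (p q : Fin 2) : p + (p + q) = q := by
  decide +revert

theorem eq_update_add_comm {j k : Fin N} (hjk : j ≠ k) (r c : Fin N → Fin 2) :
    r = Function.update c k (c j + c k) ↔ c = Function.update r k (r j + r k) := by
  have key : ∀ x c : Fin N → Fin 2, x = Function.update c k (c j + c k) →
      c = Function.update x k (x j + x k) := by
    rintro x c rfl
    simp [Function.update_of_ne hjk, add_add_cancel_bit]
  exact ⟨key r c, key c r⟩

theorem cnot_mulVec {j k : Fin N} (hjk : j ≠ k) (v : (Fin N → Fin 2) → ℝ) (r : Fin N → Fin 2) :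
    (cnot j k *ᵥ v) r = v (Function.update r k (r j + r k)) := by
  simp [cnot, Matrix.mulVec, dotProduct, eq_update_add_comm hjk r]

theorem cnot_mul_self {j k : Fin N} (hjk : j ≠ k) : cnot j k * cnot j k = 1 := by
  refine Matrix.ext_of_mulVec_single fun c => ?_
  rw [← Matrix.mulVec_mulVec, Matrix.one_mulVec]
  generalize (Pi.single c 1 : (Fin N → Fin 2) → ℝ) = v
  ext r
  have : r j + (r j + r k) = r k := add_add_cancel_bit _ _
  simp [cnot_mulVec hjk, Function.update_of_ne hjk, this]

theorem cnot_transpose {j k : Fin N} (hjk : j ≠ k) : (cnot j k)ᵀ = cnot j k := by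
  ext r c
  simp only [cnot, Matrix.transpose_apply, Matrix.of_apply]
  exact if_congr (eq_update_add_comm hjk c r) rfl rfl

theorem cnot_mem_orthogonalGroup {j k : Fin N} (hjk : j ≠ k) :
    cnot j k ∈ Matrix.orthogonalGroup (Fin N → Fin 2) ℝ := by
  rw [Matrix.mem_orthogonalGroup_iff, cnot_transpose hjk, cnot_mul_self hjk]

theorem cnot_eq_commutator {j k l : Fin N} (hjk : j ≠ k) (hjl : j ≠ l) (hlk : l ≠ k) :
    cnot j k = cnot j l * cnot l k * cnot j l * cnot l k := by
  refine Matrix.ext_of_mulVec_single fun c => ?_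
  generalize (Pi.single c 1 : (Fin N → Fin 2) → ℝ) = v
  rw [← Matrix.mulVec_mulVec, ← Matrix.mulVec_mulVec, ← Matrix.mulVec_mulVec]
  ext r
  simp only [cnot_mulVec hjk, cnot_mulVec hjl, cnot_mulVec hlk]
  congr 1
  ext m : 1
  have h₁ : r l + (r j + r l + r k) = r j + r k := by
    rw [add_left_comm, add_assoc, add_add_cancel_bit]
  have h₂ : r j + (r j + r l) = r l := add_add_cancel_bit _ _
  by_cases hm : m = k
  · subst hm; simp [hjk, hjl, hlk, hlk.symm, h₁, h₂]
  by_cases hm' : m = l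
  · subst hm'; simp [hjk, hjl, hlk, hlk.symm, h₁, h₂]
  simp [hm, hm']

theorem det_cnot (hN : 3 ≤ N) {j k : Fin N} (hjk : j ≠ k) : (cnot j k).det = 1 := by
  obtain ⟨l, hl⟩ : ∃ l, l ∉ ({j, k} : Finset (Fin N)) := by
    by_contra! h
    have := Finset.card_le_card (fun l _ => h l : (Finset.univ : Finset (Fin N)) ⊆ _)
    have := this.trans Finset.card_le_two
    simp at this
    omega
  obtain ⟨hlj, hlk⟩ : l ≠ j ∧ l ≠ k := by simpa using hl
  have h₁ := congrArg Matrix.det (cnot_mul_self hlj.symm)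
  have h₂ := congrArg Matrix.det (cnot_mul_self hlk)
  rw [Matrix.det_mul, Matrix.det_one] at h₁ h₂
  rw [cnot_eq_commutator hjk hlj.symm hlk]
  simp only [Matrix.det_mul]
  linear_combination (cnot l k).det * (cnot l k).det * h₁ + h₂

theorem localGate_apply (k : Fin N) (R : Matrix (Fin 2) (Fin 2) ℝ) (r c : Fin N → Fin 2) :
    localGate k R r c = R (r k) (c k) * if ∀ j, j ≠ k → r j = c j then 1 else 0 := by
  simp only [localGate, tensorString, Matrix.of_apply]
  rw [← Finset.mul_prod_erase _ _ (Finset.mem_univ k), if_pos rfl]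
  congr 1
  rw [Finset.prod_congr rfl fun j hj => by
    rw [if_neg (Finset.ne_of_mem_erase hj), Matrix.one_apply], Finset.prod_ite_zero]
  simp

theorem det_localGate (hN : 2 ≤ N) (k : Fin N) {R : Matrix (Fin 2) (Fin 2) ℝ}
    (hR : R ∈ Matrix.orthogonalGroup (Fin 2) ℝ) : (localGate k R).det = 1 := by
  have h : localGate k R = Matrix.reindex (Equiv.funSplitAt k (Fin 2)).symm
      (Equiv.funSplitAt k (Fin 2)).symm
      (Matrix.kroneckerMap (· * ·) R (1 : Matrix ({j // j ≠ k} → Fin 2) _ ℝ)) := by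
    ext r c
    simp [localGate_apply, Matrix.one_apply, funext_iff]
  have hR2 : R.det ^ 2 = 1 := by
    have := congrArg Matrix.det ((Matrix.mem_orthogonalGroup_iff _ _).1 hR)
    rw [Matrix.det_mul, Matrix.det_transpose, Matrix.det_one] at this
    rw [sq, this]
  obtain ⟨m, rfl⟩ := Nat.exists_eq_add_of_le hN
  rw [h, Matrix.det_reindex_self, Matrix.det_kronecker]
  simp [show 2 + m - 1 = m + 1 by omega, pow_succ' 2 m, pow_mul, hR2]

theorem det_eq_one_of_mem_closure (hN : 3 ≤ N) {W : Matrix.orthogonalGroup (Fin N → Fin 2) ℝ}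
    (hW : W ∈ Subgroup.closure (gateSet N)) :
    (W : Matrix (Fin N → Fin 2) (Fin N → Fin 2) ℝ).det = 1 := by
  induction hW using Subgroup.closure_induction with
  | mem W hW =>
    rcases hW with ⟨j, k, hjk, h⟩ | ⟨k, R, hR, h⟩
    · rw [h, det_cnot hN hjk]
    · rw [h, det_localGate (by omega) k hR]
  | one => simp
  | mul U V _ _ hU hV => rw [Submonoid.coe_mul, Matrix.det_mul, hU, hV, one_mul]
  | inv U _ hU =>
    have : ((U⁻¹ * U : Matrix.orthogonalGroup (Fin N → Fin 2) ℝ) :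
      Matrix (Fin N → Fin 2) (Fin N → Fin 2) ℝ).det = 1 := by simp
    rwa [Submonoid.coe_mul, Matrix.det_mul, hU, mul_one] at this

/-- The bit string with its `k`-th bit flipped. -/
def flipBit (k : Fin N) (b : Fin N → Fin 2) : Fin N → Fin 2 :=
  Function.update b k (b k + 1)

theorem flipBit_flipBit (k : Fin N) (b : Fin N → Fin 2) : flipBit k (flipBit k b) = b := by
  have : b k + 1 + 1 = b k := by rw [add_assoc]; simp
  simp [flipBit, this]

/-- The angle `±θ`, with sign given by the `k`-th bit, on the strings that agree with `a` on `S`,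
and `0` elsewhere. -/
def controlledAngle (k : Fin N) (S : Finset (Fin N)) (a : Fin N → Fin 2) (θ : ℝ)
    (b : Fin N → Fin 2) : ℝ :=
  if ∀ j ∈ S, b j = a j then if b k = 0 then -θ else θ else 0

theorem controlledAngle_flipBit {k : Fin N} {S : Finset (Fin N)} (hk : k ∉ S) (a : Fin N → Fin 2)
    (θ : ℝ) (b : Fin N → Fin 2) :
    controlledAngle k S a θ (flipBit k b) = -controlledAngle k S a θ b := by
  have h : (∀ j ∈ S, flipBit k b j = a j) ↔ ∀ j ∈ S, b j = a j :=
    forall₂_congr fun j hj => by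
      rw [flipBit, Function.update_of_ne (ne_of_mem_of_not_mem hj hk)]
  simp only [controlledAngle, h, show flipBit k b k = b k + 1 from Function.update_self ..]
  generalize b k = p
  by_cases h' : ∀ j ∈ S, b j = a j
  · simp only [if_pos h']
    fin_cases p <;> simp
  · simp only [if_neg h', neg_zero]

theorem cnot_mul_pairRotation_mul_cnot {j k : Fin N} (hjk : j ≠ k) {α : (Fin N → Fin 2) → ℝ}
    (hα : ∀ b, α (flipBit k b) = -α b) :
    cnot j k * pairRotation (flipBit k) α * cnot j k =
      pairRotation (flipBit k) fun b => if b j = 0 then α b else -α b := by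
  have hP : ∀ b : Fin N → Fin 2,
      Function.update b k (b j + b k) = if b j = 0 then b else flipBit k b := by
    intro b
    split_ifs with h
    · simp [h]
    · rw [flipBit, Fin.eq_one_of_ne_zero _ h, add_comm]
  have hj : ∀ b, flipBit k b j = b j := fun b => by rw [flipBit, Function.update_of_ne hjk]
  refine Matrix.ext_of_mulVec_single fun c => ?_
  rw [← Matrix.mulVec_mulVec, ← Matrix.mulVec_mulVec]
  ext r
  simp only [cnot_mulVec hjk, pairRotation_mulVec, hP]
  split_ifs with h₁ h₂ <;> simp_all [flipBit_flipBit]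

theorem localGate_rotation (k : Fin N) (a : Fin N → Fin 2) (θ : ℝ) :
    localGate k !![Real.cos θ, -Real.sin θ; Real.sin θ, Real.cos θ] =
      pairRotation (flipBit k) (controlledAngle k ∅ a θ) := by
  ext r c
  have heq : c = r ↔ c k = r k ∧ ∀ j, j ≠ k → r j = c j :=
    ⟨by rintro rfl; simp, fun ⟨h, h'⟩ => funext fun j => by
      by_cases hj : j = k
      · rw [hj, h]
      · exact (h' j hj).symm⟩
  have hflip : c = flipBit k r ↔ c k = r k + 1 ∧ ∀ j, j ≠ k → r j = c j :=
    ⟨by rintro rfl; simp +contextual [flipBit], fun ⟨h, h'⟩ => funext fun j => by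
      by_cases hj : j = k
      · rw [hj, h, flipBit, Function.update_self]
      · rw [flipBit, Function.update_of_ne hj, h' j hj]⟩
  rw [localGate_apply]
  simp only [pairRotation, Matrix.of_apply, Pi.add_apply, Pi.smul_apply, Pi.single_apply,
    heq, hflip, controlledAngle]
  by_cases h : ∀ j, j ≠ k → r j = c j
  · simp only [iff_true_intro h, and_true]
    generalize r k = p
    generalize c k = q
    fin_cases p <;> fin_cases q <;> simp
  · simp [h]

theorem exists_mem_closure_pairRotation (k : Fin N) (a : Fin N → Fin 2) (S : Finset (Fin N))
    (hk : k ∉ S) (θ : ℝ) : ∃ W ∈ Subgroup.closure (gateSet N),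
      (W : Matrix (Fin N → Fin 2) (Fin N → Fin 2) ℝ) =
        pairRotation (flipBit k) (controlledAngle k S a θ) := by
  induction S using Finset.induction_on generalizing θ with
  | empty =>
    refine ⟨⟨_, pairRotation_mem_orthogonalGroup (flipBit_flipBit k)
      (controlledAngle_flipBit hk a θ)⟩, Subgroup.subset_closure (Or.inr ⟨k, _, ?_,
        (localGate_rotation k a θ).symm⟩), rfl⟩
    rw [Matrix.mem_orthogonalGroup_iff]
    have := Real.sin_sq_add_cos_sq θ
    ext i j
    fin_cases i <;> fin_cases j <;> simp [Matrix.mul_apply, Fin.sum_univ_two] <;> linarith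
  | insert j S hj ih =>
    obtain ⟨hkj, hkS⟩ : k ≠ j ∧ k ∉ S := by simpa using hk
    obtain ⟨U, hU, hUe⟩ := ih hkS (θ / 2)
    obtain ⟨V, hV, hVe⟩ := ih hkS (if a j = 0 then θ / 2 else -(θ / 2))
    have hX : (⟨cnot j k, cnot_mem_orthogonalGroup hkj.symm⟩ :
        Matrix.orthogonalGroup (Fin N → Fin 2) ℝ) ∈ Subgroup.closure (gateSet N) :=
      Subgroup.subset_closure (Or.inl ⟨j, k, hkj.symm, rfl⟩)
    refine ⟨_, mul_mem hU (mul_mem (mul_mem hX hV) hX), ?_⟩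
    simp only [Submonoid.coe_mul]
    rw [hUe, hVe, cnot_mul_pairRotation_mul_cnot hkj.symm (controlledAngle_flipBit hkS a _),
      pairRotation_mul (flipBit_flipBit k)]
    · congr 1
      ext b
      simp only [controlledAngle, Pi.add_apply, Finset.forall_mem_insert]
      by_cases h : ∀ i ∈ S, b i = a i
      · simp only [iff_true_intro h, and_true, if_true]
        generalize a j = p
        generalize b j = q
        generalize b k = s
        fin_cases p <;> fin_cases q <;> fin_cases s <;> simp <;> ring
      · simp [h]
    · intro b
      rw [flipBit, Function.update_of_ne hkj.symm, ← flipBit, controlledAngle_flipBit hkS]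
      split_ifs <;> rfl

theorem exists_mem_closure_givens_flipBit (k : Fin N) (a : Fin N → Fin 2) (θ : ℝ) :
    ∃ W ∈ Subgroup.closure (gateSet N),
      (W : Matrix (Fin N → Fin 2) (Fin N → Fin 2) ℝ) = givens a (flipBit k a) θ := by
  obtain ⟨W, hW, h⟩ := exists_mem_closure_pairRotation k a {k}ᶜ (by simp)
    (if a k = 0 then θ else -θ)
  refine ⟨W, hW, h.trans ?_⟩
  have hne : a ≠ flipBit k a := fun h => by
    have := congrFun h k
    simp [flipBit] at this
  set α := controlledAngle k {k}ᶜ a (if a k = 0 then θ else -θ) with hα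
  have ha : α a = -θ := by
    simp only [hα, controlledAngle]
    split_ifs <;> simp at *
  have ha' : α (flipBit k a) = θ := by
    rw [hα, controlledAngle_flipBit (by simp), ← hα, ha, neg_neg]
  have hr : ∀ r, r ≠ a → r ≠ flipBit k a → α r = 0 := by
    intro r h₁ h₂
    refine if_neg fun h => ?_
    by_cases hrk : r k = a k
    · exact h₁ (funext fun j => by
        by_cases hj : j = k
        · rw [hj, hrk]
        · exact h j (by simp [hj]))
    · refine h₂ (funext fun j => ?_)
      by_cases hj : j = k
      · rw [hj, flipBit, Function.update_self]
        generalize r k = p at hrk ⊢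
        generalize a k = q at hrk ⊢
        decide +revert
      · rw [flipBit, Function.update_of_ne hj, h j (by simp [hj])]
  refine Matrix.ext_of_mulVec_single fun c => ?_
  generalize (Pi.single c 1 : (Fin N → Fin 2) → ℝ) = v
  rw [givens_mulVec hne]
  ext r
  rw [pairRotation_mulVec]
  split_ifs with h₁ h₂
  · rw [h₁, ha, Real.cos_neg, Real.sin_neg]
    ring
  · rw [h₂, ha', flipBit_flipBit]
  · simp [hr r h₁ h₂]

theorem exists_mem_closure_givens {a b : Fin N → Fin 2} (hab : a ≠ b) (θ : ℝ) :
    ∃ W ∈ Subgroup.closure (gateSet N),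
      (W : Matrix (Fin N → Fin 2) (Fin N → Fin 2) ℝ) = givens a b θ := by
  suffices H : ∀ (s : Finset (Fin N)) (b : Fin N → Fin 2), (∀ j ∉ s, b j = a j) → a ≠ b →
      ∀ θ, ∃ W ∈ Subgroup.closure (gateSet N),
        (W : Matrix (Fin N → Fin 2) (Fin N → Fin 2) ℝ) = givens a b θ from
    H Finset.univ b (by simp) hab θ
  intro s
  induction s using Finset.induction_on with
  | empty => exact fun b hb h => absurd (funext fun j => (hb j (by simp)).symm) h
  | insert k s hk ih =>
    intro b hb hab θ
    by_cases hbk : b k = a k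
    · refine ih b (fun j hj => ?_) hab θ
      by_cases hjk : j = k
      · rw [hjk, hbk]
      · exact hb j (by simp [hjk, hj])
    · have hflip : flipBit k b k = a k := by
        simp only [flipBit, Function.update_self]
        generalize b k = p at hbk
        generalize a k = q at hbk
        decide +revert
      have hne : flipBit k b ≠ b := fun h => hbk (by rw [← hflip, h])
      by_cases hac : a = flipBit k b
      · have := exists_mem_closure_givens_flipBit k a θ
        rwa [show flipBit k a = b by rw [hac, flipBit_flipBit]] at this
      · obtain ⟨W, hW, hWe⟩ := ih (flipBit k b) (fun j hj => by
          by_cases hjk : j = k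
          · rw [hjk, hflip]
          · rw [flipBit, Function.update_of_ne hjk, hb j (by simp [hjk, hj])]) hac θ
        have hQ := exists_mem_closure_givens_flipBit k (flipBit k b)
        rw [flipBit_flipBit] at hQ
        obtain ⟨U, hU, hUe⟩ := hQ (Real.pi / 2)
        obtain ⟨V, hV, hVe⟩ := hQ (-(Real.pi / 2))
        refine ⟨U * W * V, mul_mem (mul_mem hU hW) hV, ?_⟩
        rw [Submonoid.coe_mul, Submonoid.coe_mul, hUe, hWe, hVe, givens_conj hac hne hab]

end Gates

/-- For `N ≥ 3` the group generated by C-NOTs and local one-rebit orthogonal gates is exactly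
`SO(2^N)`: an orthogonal matrix lies in it if and only if its determinant is `1`. -/
theorem cnot_local_gates_generate_exactly_SO (N : ℕ) (hN : 3 ≤ N) :
    ∀ A : Matrix.orthogonalGroup (Fin N → Fin 2) ℝ,
      A ∈ Subgroup.closure (gateSet N) ↔
        (A : Matrix (Fin N → Fin 2) (Fin N → Fin 2) ℝ).det = 1 :=
  fun _ => ⟨det_eq_one_of_mem_closure hN,
    mem_of_det_eq_one (fun _ => det_eq_one_of_mem_closure hN)
      fun _ _ hab θ => exists_mem_closure_givens hab θ⟩
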